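/- No finite non-abelian simple group satisfies the MGSE property. -/

import Mathlib

/-- A subset `S` of a group is a minimal generating set if it generates the whole
group but no proper subset obtained by removing one element does. -/
def IsMinimalGeneratingSet {G : Type*} [Group G] (S : Set G) : Prop :=
  Subgroup.closure S = ⊤ ∧ ∀ s ∈ S, Subgroup.closure (S \ {s}) ≠ ⊤

/-- `minGen G = d(G)` is the minimal size of a generating set of `G`. -/
noncomputable def minGen (G : Type*) [Group G] : ℕ :=
  sInf {n | ∃ S : Finset G, S.card = n ∧ Subgroup.closure (S : Set G) = ⊤}

/-- The minimal generating set exchange property (MGSE): whenever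
`G = ⟨x_1,…,x_d⟩ = ⟨y_1,…,y_d⟩` with `d = d(G)`, for every `i` there exists `j`
such that replacing `x_i` by `y_j` still yields a generating set. -/
def MGSE (G : Type*) [Group G] : Prop :=
  ∀ x y : Fin (minGen G) → G,
    Subgroup.closure (Set.range x) = ⊤ → Subgroup.closure (Set.range y) = ⊤ →
    ∀ i : Fin (minGen G), ∃ j : Fin (minGen G),
      Subgroup.closure (Set.range (Function.update x i (y j))) = ⊤

section Relation
variable {G : Type*} [Group G]

/-- The elements related to everything are closed under multiplication. -/
theorem mul_mem_radical {r : G → G → Prop}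
    (symm : ∀ a b, r a b → r b a)
    (mul_left : ∀ a b, r a (b * a) ↔ r a b) (inv : ∀ a b, r a b → r a b⁻¹)
    (trans : ∀ v, (∃ w, ¬ r v w) → ∀ a b, r v a → r v b → r a b)
    (gen : Subgroup.closure {v | ∃ w, ¬ r v w} = ⊤)
    {a b : G} (ha : ∀ w, r a w) (hb : ∀ w, r b w) (w : G) : r (a * b) w := by
  have inv_left : ∀ {a b}, r a⁻¹ b → r a b := fun {a b} h => by
    have := symm _ _ (inv _ _ (symm _ _ h))
    rwa [inv_inv] at this
  have inv_rad : ∀ {a}, (∀ w, r a w) → ∀ w, r a⁻¹ w := fun h w => inv_left (by simpa using h w)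
  have key : ∀ a b y, (∀ w, r a w) → (∀ w, r b w) → ¬ r (a * b) y → ∀ w, r (b * y) w := by
    intro a b y ha hb hy
    by_contra! hby
    have h₁ : r (b * y) (a * (b * y)) := (mul_left _ _).2 (symm _ _ (ha _))
    have h₂ : r (b * y) y := symm _ _ ((mul_left _ _).2 (symm _ _ (hb _)))
    have h₃ := trans _ hby _ _ h₁ h₂
    rw [← mul_assoc] at h₃
    exact hy (symm _ _ ((mul_left _ _).1 (symm _ _ h₃)))
  have key' : ∀ a b y, (∀ w, r a w) → (∀ w, r b w) → ¬ r (a * b) y → ∀ w, r (a⁻¹ * y) w := by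
    intro a b y ha hb hy
    refine key b⁻¹ a⁻¹ y (inv_rad hb) (inv_rad ha) fun h => hy (inv_left ?_)
    rwa [mul_inv_rev]
  let T : G → Prop := fun b => (∀ w, r b w) ∧ ∃ a, (∀ w, r a w) ∧ ∃ w, ¬ r (a * b) w
  have step : ∀ b, T b → ∀ z, (∃ w, ¬ r z w) → T (b * z) := by
    rintro b ⟨hb, a, ha, y, hy⟩ z hz
    have hbz : ∀ w, r (b * z) w := by
      by_cases hxz : r (a * b) z
      · have hyz : ¬ r y z := fun h =>
          hy (trans z hz _ _ (symm _ _ hxz) (symm _ _ h))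
        have := key' b⁻¹ (b * y) z (inv_rad hb) (key a b y ha hb hy) (by simpa using hyz)
        simpa using this
      · exact key a b z ha hb hxz
    exact ⟨hbz, b⁻¹, inv_rad hb, by simpa using hz⟩
  by_contra hw
  have hT : T b := ⟨hb, a, ha, w, hw⟩
  have all : ∀ g, ∀ b, T b → T (b * g) := by
    intro g
    have hg : g ∈ Subgroup.closure {v | ∃ w, ¬ r v w} := gen ▸ Subgroup.mem_top g
    induction hg using Subgroup.closure_induction'' with
    | mem x hx => exact fun b hb => step b hb x hx
    | inv_mem x hx =>
      obtain ⟨w, hw⟩ := hx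
      exact fun b hb => step b hb _ ⟨w, fun h => hw (inv_left h)⟩
    | one => simp
    | mul x y _ _ hx hy => exact fun b hb => by rw [← mul_assoc]; exact hy _ (hx b hb)
  have := (all (b⁻¹ * (a * b)) b hT).1 w
  rw [mul_inv_cancel_left] at this
  exact hw this

theorem rel_mul_of_rel {r : G → G → Prop}
    (symm : ∀ a b, r a b → r b a)
    (mul_left : ∀ a b, r a (b * a) ↔ r a b) (mul_right : ∀ a b, r a (a * b) ↔ r a b)
    (inv : ∀ a b, r a b → r a b⁻¹)
    (trans : ∀ v, (∃ w, ¬ r v w) → ∀ a b, r v a → r v b → r a b)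
    (gen : Subgroup.closure {v | ∃ w, ¬ r v w} = ⊤)
    {v a b : G} (hv : ∃ w, ¬ r v w) (ha : r v a) (hb : r v b) : r v (a * b) := by
  have hab := trans v hv a b ha hb
  by_cases hav : ∃ w, ¬ r a w
  · exact trans a hav _ _ (symm _ _ ha) ((mul_right _ _).2 hab)
  by_cases hbv : ∃ w, ¬ r b w
  · exact trans b hbv _ _ (symm _ _ hb) ((mul_left _ _).2 (symm _ _ hab))
  push Not at hav hbv
  exact symm _ _ (mul_mem_radical symm mul_left inv trans gen hav hbv v)
end Relation

theorem zpowers_ne_top {G : Type*} [Group G] (hnonab : ∃ a b : G, a * b ≠ b * a) (g : G) :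
    Subgroup.zpowers g ≠ ⊤ := by
  intro htop
  obtain ⟨a, b, hab⟩ := hnonab
  obtain ⟨m, rfl⟩ : a ∈ Subgroup.zpowers g := htop ▸ Subgroup.mem_top a
  obtain ⟨n, rfl⟩ : b ∈ Subgroup.zpowers g := htop ▸ Subgroup.mem_top b
  exact hab (zpow_mul_comm g m n)

theorem exists_injective_fin_range_eq {α : Type*} [Finite α] {S : Set α} {n : ℕ}
    (hS : S.ncard = n) :
    ∃ x : Fin n → α, Function.Injective x ∧ Set.range x = S := by
  have e : Fin n ≃ S := (Finite.equivFinOfCardEq (by rwa [Nat.card_coe_set_eq])).symm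
  exact ⟨fun i => e i, Subtype.val_injective.comp e.injective, by
    rw [show (fun i => (e i : α)) = Subtype.val ∘ e from rfl, e.surjective.range_comp]; simp⟩

section Generation
variable {G : Type*} [Group G] [Finite G]

theorem minGen_le_ncard {S : Set G} (hS : Subgroup.closure S = ⊤) : minGen G ≤ S.ncard := by
  classical
  have hfin : S.Finite := S.toFinite
  exact Nat.sInf_le ⟨hfin.toFinset, by rw [Set.ncard_eq_toFinset_card S hfin], by simpa using hS⟩

theorem exists_closure_eq_top_ncard_eq_minGen :
    ∃ S : Set G, S.ncard = minGen G ∧ Subgroup.closure S = ⊤ := by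
  classical
  have hne : {n | ∃ S : Finset G, S.card = n ∧ Subgroup.closure (S : Set G) = ⊤}.Nonempty :=
    ⟨_, (Set.univ : Set G).toFinite.toFinset, rfl, by simp⟩
  obtain ⟨S, hS, hgen⟩ := Nat.sInf_mem hne
  exact ⟨S, by rw [Set.ncard_coe_finset]; exact hS, hgen⟩

theorem two_le_minGen (hnonab : ∃ a b : G, a * b ≠ b * a) : 2 ≤ minGen G := by
  by_contra! hlt
  obtain ⟨S, hc, hS⟩ := exists_closure_eq_top_ncard_eq_minGen (G := G)
  rcases (Set.ncard_le_one_iff_eq (Set.toFinite S)).1 (by omega) with rfl | ⟨a, rfl⟩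
  · exact zpowers_ne_top hnonab 1 (by rw [← hS]; simp)
  · exact zpowers_ne_top hnonab a (by rw [← hS, Subgroup.zpowers_eq_closure])

/-- Under the exchange property, the generating sets of minimal size satisfy the basis
exchange axiom. -/
theorem MGSE.exchangeProperty (h : MGSE G) :
    Matroid.ExchangeProperty
      (fun B : Set G => B.ncard = minGen G ∧ Subgroup.closure B = ⊤) := by
  rintro X Y ⟨hXc, hX⟩ ⟨hYc, hY⟩ a ⟨haX, haY⟩
  obtain ⟨x, hxi, rfl⟩ := exists_injective_fin_range_eq hXc
  obtain ⟨y, -, rfl⟩ := exists_injective_fin_range_eq hYc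
  obtain ⟨i, rfl⟩ := haX
  obtain ⟨j, hj⟩ := h x y hX hY i
  have hrange : Set.range (Function.update x i (y j)) ⊆ insert (y j) (Set.range x \ {x i}) := by
    rintro _ ⟨k, rfl⟩
    by_cases hk : k = i
    · subst hk; simp
    · rw [Function.update_of_ne hk]
      exact Or.inr ⟨⟨k, rfl⟩, fun h => hk (hxi h)⟩
  have hgen : Subgroup.closure (insert (y j) (Set.range x \ {x i})) = ⊤ :=
    top_le_iff.1 (hj ▸ Subgroup.closure_mono hrange)
  have hcard : (Set.range x \ {x i}).ncard + 1 = minGen G := by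
    rw [Set.ncard_sdiff_singleton_add_one (Set.mem_range_self i) (Set.toFinite _), hXc]
  have hnew : y j ∉ Set.range x \ {x i} := by
    intro hmem
    rw [Set.insert_eq_of_mem hmem] at hgen
    have := minGen_le_ncard hgen
    omega
  refine ⟨y j, ⟨⟨j, rfl⟩, fun hmem => hnew ⟨hmem, fun h => haY ⟨j, h⟩⟩⟩, ?_, hgen⟩
  rw [Set.ncard_insert_of_notMem hnew (Set.toFinite _), hcard]

/-- The matroid whose bases are the generating sets of minimal size. -/
noncomputable def MGSE.matroid (h : MGSE G) : Matroid G :=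
  Matroid.ofIsBaseOfFinite (Set.toFinite Set.univ)
    (fun B : Set G => B.ncard = minGen G ∧ Subgroup.closure B = ⊤)
    exists_closure_eq_top_ncard_eq_minGen h.exchangeProperty fun _ _ => Set.subset_univ _

theorem MGSE.matroid_isBase_iff (h : MGSE G) {B : Set G} :
    h.matroid.IsBase B ↔ B.ncard = minGen G ∧ Subgroup.closure B = ⊤ := Iff.rfl

theorem MGSE.isBase_of_ncard_le (h : MGSE G) {B : Set G} (hc : B.ncard ≤ minGen G)
    (hB : Subgroup.closure B = ⊤) : h.matroid.IsBase B :=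
  ⟨le_antisymm hc (minGen_le_ncard hB), hB⟩

theorem MGSE.ncard_sdiff_singleton (h : MGSE G) {B : Set G} (hB : h.matroid.IsBase B) {e : G}
    (he : e ∈ B) : (B \ {e}).ncard + 1 = minGen G := by
  rw [Set.ncard_sdiff_singleton_add_one he (Set.toFinite _), (h.matroid_isBase_iff.1 hB).1]

theorem MGSE.mem_closure_sdiff_iff (h : MGSE G) {B : Set G} (hB : h.matroid.IsBase B) {e : G}
    (he : e ∈ B) (a : G) :
    a ∈ h.matroid.closure (B \ {e}) ↔ Subgroup.closure (insert a (B \ {e})) ≠ ⊤ := by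
  constructor
  · intro ha hgen
    have hbase : h.matroid.IsBase (insert a (B \ {e})) := by
      refine h.isBase_of_ncard_le ((Set.ncard_insert_le _ _).trans ?_) hgen
      rw [h.ncard_sdiff_singleton hB he]
    have hcl := hbase.closure_eq
    rw [Matroid.closure_insert_eq_of_mem_closure ha] at hcl
    exact hB.indep.notMem_closure_sdiff_of_mem he (hcl ▸ Set.mem_univ e)
  · intro hgen
    by_contra ha
    exact hgen (hB.exchange_base_of_notMem_closure he ha (Set.mem_univ a)).2

/-- Hyperplanes of the matroid of minimal generating sets are subgroups. -/
theorem MGSE.exists_subgroup_eq_hyperplane (h : MGSE G) (hd : 2 ≤ minGen G) {B : Set G}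
    (hB : h.matroid.IsBase B) {e : G} (he : e ∈ B) :
    ∃ N : Subgroup G, (N : Set G) = h.matroid.closure (B \ {e}) := by
  have hcard := h.ncard_sdiff_singleton hB he
  obtain ⟨f, hf⟩ : (B \ {e}).Nonempty := by
    rw [← Set.ncard_pos]; omega
  set K : Set G := (B \ {e}) \ {f} with hK
  have hfK : insert f K = B \ {e} := by simp [hK, Set.insert_eq_of_mem hf]
  have hefK : insert e (insert f K) = B := by rw [hfK]; simp [Set.insert_eq_of_mem he]
  have hKc : K.ncard + 2 = minGen G := by
    rw [← hcard, hK, ← Set.ncard_sdiff_singleton_add_one hf (Set.toFinite _)]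
  let r : G → G → Prop := fun a b => Subgroup.closure (insert b (insert a K)) ≠ ⊤
  have symm : ∀ a b, r a b → r b a := fun a b hab => by
    change Subgroup.closure _ ≠ ⊤
    rwa [Set.insert_comm]
  have mono : ∀ a b c, c ∈ Subgroup.closure (insert b (insert a K)) → r a b → r a c := by
    intro a b c hc hab hgen
    refine hab (top_le_iff.1 (hgen ▸ (Subgroup.closure_le _).2 ?_))
    exact Set.insert_subset hc ((Set.subset_insert _ _).trans Subgroup.subset_closure)
  have mem₁ : ∀ a b, b ∈ Subgroup.closure (insert b (insert a K)) :=
    fun a b => Subgroup.subset_closure (by simp)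
  have mem₂ : ∀ a b, a ∈ Subgroup.closure (insert b (insert a K)) :=
    fun a b => Subgroup.subset_closure (by simp)
  have mul_left : ∀ a b, r a (b * a) ↔ r a b := fun a b =>
    ⟨mono _ _ _ (by simpa using mul_mem (mem₁ a (b * a)) (inv_mem (mem₂ a (b * a)))),
      mono _ _ _ (mul_mem (mem₁ a b) (mem₂ a b))⟩
  have mul_right : ∀ a b, r a (a * b) ↔ r a b := fun a b =>
    ⟨mono _ _ _ (by simpa using mul_mem (inv_mem (mem₂ a (a * b))) (mem₁ a (a * b))),
      mono _ _ _ (mul_mem (mem₂ a b) (mem₁ a b))⟩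
  have inv : ∀ a b, r a b → r a b⁻¹ := fun a b => mono _ _ _ (inv_mem (mem₁ a b))
  have isBase : ∀ v w, ¬ r v w → h.matroid.IsBase (insert w (insert v K)) := fun v w hvw => by
    refine h.isBase_of_ncard_le ?_ (not_not.1 hvw)
    have h₁ := Set.ncard_insert_le w (insert v K)
    have h₂ := Set.ncard_insert_le v K
    omega
  have rel_iff : ∀ v, (∃ w, ¬ r v w) → ∀ a, r v a ↔ a ∈ h.matroid.closure (insert v K) := by
    rintro v ⟨w, hvw⟩ a
    have hbase := isBase v w hvw
    have hw : w ∉ insert v K := by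
      intro hw
      have h₁ := (h.matroid_isBase_iff.1 hbase).1
      rw [Set.insert_eq_of_mem hw] at h₁
      have h₂ := Set.ncard_insert_le v K
      omega
    have := h.mem_closure_sdiff_iff hbase (Set.mem_insert _ _) a
    rw [Set.insert_sdiff_self_of_notMem hw] at this
    exact this.symm
  have trans : ∀ v, (∃ w, ¬ r v w) → ∀ a b, r v a → r v b → r a b := by
    intro v hv a b ha hb
    by_contra hab
    rw [rel_iff v hv] at ha hb
    have hsub : insert b (insert a K) ⊆ h.matroid.closure (insert v K) :=
      Set.insert_subset hb (Set.insert_subset ha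
        ((Set.subset_insert _ _).trans (h.matroid.subset_closure _ (Set.subset_univ _))))
    obtain ⟨w, hw⟩ := hv
    refine hw ((rel_iff v ⟨w, hw⟩ w).2 ?_)
    exact h.matroid.closure_subset_closure_of_subset_closure hsub
      ((isBase a b (not_not.2 hab)).closure_eq ▸ Set.mem_univ w)
  have hfe : ¬ r f e := not_not.2 (by rw [hefK]; exact hB.2)
  have hV : ∃ w, ¬ r f w := ⟨e, hfe⟩
  have gen : Subgroup.closure {v | ∃ w, ¬ r v w} = ⊤ := by
    rw [← top_le_iff, ← (h.matroid_isBase_iff.1 hB).2, Subgroup.closure_le, ← hefK]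
    have hf' : f ∈ Subgroup.closure {v | ∃ w, ¬ r v w} := Subgroup.subset_closure hV
    refine Set.insert_subset (Subgroup.subset_closure ⟨f, fun h => hfe (symm _ _ h)⟩)
      (Set.insert_subset hf' fun k hk => ?_)
    have hkf : k * f ∈ Subgroup.closure {v | ∃ w, ¬ r v w} := by
      refine Subgroup.subset_closure ⟨e, fun hr =>
        hfe (symm _ _ (mono _ (k * f) _ ?_ (symm _ _ hr)))⟩
      have hk' : k ∈ Subgroup.closure (insert (k * f) (insert e K)) :=
        Subgroup.subset_closure (by simp [hk])
      simpa using mul_mem (inv_mem hk') (mem₁ e (k * f))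
    simpa using mul_mem hkf (inv_mem hf')
  refine ⟨{ carrier := {a | r f a}
            mul_mem' := fun ha hb => rel_mul_of_rel symm mul_left mul_right inv trans gen hV ha hb
            one_mem' := fun hgen => ?_
            inv_mem' := fun ha => inv _ _ ha }, ?_⟩
  · rw [Subgroup.closure_insert_one, hfK] at hgen
    have := minGen_le_ncard hgen
    omega
  · exact (Set.ext (rel_iff f hV)).trans (by rw [hfK])

/-- The intersection of the maximal subgroups containing a set. -/
def coatomHull {G : Type*} [Group G] (A : Set G) : Subgroup G :=
  sInf {H | IsCoatom H ∧ A ⊆ H}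

theorem MGSE.exists_isCoatom_of_notMem_closure (h : MGSE G) (hd : 2 ≤ minGen G) {A : Set G} {x : G}
    (hx : x ∉ h.matroid.closure A) :
    ∃ N : Subgroup G, IsCoatom N ∧ h.matroid.closure A ⊆ N ∧ x ∉ N := by
  have hsub : ∀ X : Set G, X ⊆ h.matroid.E := fun X => Set.subset_univ X
  obtain ⟨I, hI⟩ := h.matroid.exists_isBasis A (hsub A)
  rw [← hI.closure_eq_closure] at hx ⊢
  have hxI : x ∉ I := fun hxI => hx (h.matroid.subset_closure I (hsub I) hxI)
  have hind : h.matroid.Indep (insert x I) :=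
    (hI.indep.notMem_closure_iff_of_notMem hxI (Set.mem_univ x)).1 hx
  obtain ⟨B, hB, hIB⟩ := hind.exists_isBase_superset
  have hxB : x ∈ B := hIB (Set.mem_insert _ _)
  obtain ⟨N, hN⟩ := h.exists_subgroup_eq_hyperplane hd hB hxB
  have hxN : x ∉ N := fun hmem =>
    hB.indep.notMem_closure_sdiff_of_mem hxB (hN ▸ (hmem : x ∈ (N : Set G)))
  refine ⟨N, ⟨fun htop => hxN (htop ▸ Subgroup.mem_top x), fun H hNH => ?_⟩, ?_, hxN⟩
  · obtain ⟨hle, z, hzH, hzN⟩ := SetLike.lt_iff_le_and_exists.1 hNH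
    have hz : Subgroup.closure (insert z (B \ {x})) = ⊤ := by
      by_contra hne
      refine hzN ?_
      rw [← SetLike.mem_coe, hN]
      exact (h.mem_closure_sdiff_iff hB hxB z).2 hne
    rw [← top_le_iff, ← hz, Subgroup.closure_le]
    refine Set.insert_subset hzH fun y hy => hle ?_
    rw [← SetLike.mem_coe, hN]
    exact h.matroid.subset_closure _ (hsub _) hy
  · rw [hN]
    refine h.matroid.closure_subset_closure fun y hy => ⟨hIB (Or.inr hy), ?_⟩
    rintro rfl
    exact hxI hy

theorem MGSE.coatomHull_eq_closure (h : MGSE G) (hd : 2 ≤ minGen G) (A : Set G) :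
    (coatomHull A : Set G) = h.matroid.closure A := by
  have hsub : ∀ X : Set G, X ⊆ h.matroid.E := fun X => Set.subset_univ X
  apply Set.Subset.antisymm
  · intro x hx
    by_contra hxA
    obtain ⟨N, hN, hAN, hxN⟩ := h.exists_isCoatom_of_notMem_closure hd hxA
    exact hxN (Subgroup.mem_sInf.1 hx N ⟨hN, (h.matroid.subset_closure A (hsub A)).trans hAN⟩)
  · intro x hx
    refine Subgroup.mem_sInf.2 fun H ⟨hH, hAH⟩ => ?_
    obtain ⟨y, hy⟩ : ∃ y, y ∉ h.matroid.closure (H : Set G) := by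
      by_contra! hall
      have hspan : h.matroid.Spanning (H : Set G) :=
        (Matroid.spanning_iff_closure_eq (hsub _)).2 (Set.eq_univ_of_forall hall)
      obtain ⟨B, hB, hBH⟩ := (Matroid.spanning_iff_exists_isBase_subset (hsub _)).1 hspan
      exact hH.1 (top_le_iff.1 (hB.2 ▸ (Subgroup.closure_le H).2 hBH))
    obtain ⟨N, hN, hHN, -⟩ := h.exists_isCoatom_of_notMem_closure hd hy
    have hle : H ≤ N := (h.matroid.subset_closure _ (hsub _)).trans hHN
    have hHN' : N = H := (hH.le_iff.1 hle).resolve_left hN.1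
    subst hHN'
    exact hHN (h.matroid.closure_subset_closure hAH hx)

theorem MGSE.coatomHull_exchange (h : MGSE G) (hd : 2 ≤ minGen G) {A : Set G} {b c : G}
    (hb : b ∈ coatomHull (insert c A)) (hbA : b ∉ coatomHull A) :
    c ∈ coatomHull (insert b A) := by
  rw [← SetLike.mem_coe, h.coatomHull_eq_closure hd] at *
  exact Matroid.mem_closure_insert hbA hb
end Generation

section Hull
variable {G : Type*} [Group G]

theorem subset_coatomHull (A : Set G) : A ⊆ coatomHull A := fun _ ha =>
  Subgroup.mem_sInf.2 fun _ hH => hH.2 ha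

theorem coatomHull_le {A : Set G} {H : Subgroup G} (hH : IsCoatom H) (hA : A ⊆ H) :
    coatomHull A ≤ H :=
  sInf_le ⟨hH, hA⟩

theorem coatomHull_le_coatomHull {A B : Set G} (h : A ⊆ coatomHull B) :
    coatomHull A ≤ coatomHull B := fun _ hx =>
  Subgroup.mem_sInf.2 fun _ hH => coatomHull_le hH.1 (h.trans (coatomHull_le hH.1 hH.2)) hx

theorem conj_mem_coatomHull {g k : G} (x : G) (hk : k ∈ coatomHull {g}) :
    x * k * x⁻¹ ∈ coatomHull {x * g * x⁻¹} := by
  refine Subgroup.mem_sInf.2 fun H ⟨hH, hgH⟩ => ?_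
  have hco : IsCoatom (H.comap (MulAut.conj x).toMonoidHom) :=
    Subgroup.isCoatom_comap_of_surjective (MulAut.conj x).surjective hH
  have := coatomHull_le hco (A := {g}) (by simpa using hgH) hk
  simpa using this

theorem conj_mem_coatomHull_iff {g k : G} (x : G) :
    x * k * x⁻¹ ∈ coatomHull {x * g * x⁻¹} ↔ k ∈ coatomHull {g} := by
  refine ⟨fun h => ?_, conj_mem_coatomHull x⟩
  have := conj_mem_coatomHull x⁻¹ h
  simpa [mul_assoc] using this

/-- The exchange property of the closure operator `coatomHull`. -/
def CoatomHullExchange (G : Type*) [Group G] : Prop :=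
  ∀ (A : Set G) (b c : G), b ∈ coatomHull (insert c A) → b ∉ coatomHull A →
    c ∈ coatomHull (insert b A)

theorem normalizer_inf_coatomHull_le (hex : CoatomHullExchange G) {g r : G} {H : Subgroup G}
    (hH : IsCoatom H)
    (hN : Subgroup.normalizer (coatomHull {g} : Set G) ≤ H) (hr : r ∉ H) :
    Subgroup.normalizer (coatomHull {g} : Set G) ⊓ coatomHull {g, r} ≤ coatomHull {g} := by
  rintro s ⟨hsN, hs⟩
  by_contra hsg
  refine hr (coatomHull_le hH ?_ (hex {g} s r (by rwa [Set.pair_comm] at hs) hsg))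
  have hgH : g ∈ H := hN (Subgroup.le_normalizer (subset_coatomHull {g} rfl))
  exact Set.insert_subset (hN hsN) (by simpa using hgH)

theorem coatomHull_singleton_ne_bot {g : G} (hg : g ≠ 1) : coatomHull {g} ≠ ⊥ := fun h =>
  hg (Subgroup.mem_bot.1 (h ▸ subset_coatomHull {g} rfl))

theorem coatomHull_singleton_ne_top [Finite G] (hnonab : ∃ a b : G, a * b ≠ b * a) (g : G) :
    coatomHull {g} ≠ ⊤ := by
  obtain ⟨H, hH, hle⟩ := (eq_top_or_exists_le_coatom (Subgroup.zpowers g)).resolve_left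
    (zpowers_ne_top hnonab g)
  intro htop
  refine hH.1 (top_le_iff.1 (htop ▸ coatomHull_le hH ?_))
  simpa using hle (Subgroup.mem_zpowers g)

end Hull

section Counting
variable {G : Type*} [Group G]

/-- The nontrivial elements of the `S`-conjugates of `Q`. -/
def conjSet (S Q : Subgroup G) : Set G := {u | u ≠ 1 ∧ ∃ s ∈ S, s⁻¹ * u * s ∈ Q}

theorem conjSet_subset {S Q : Subgroup G} (hQS : Q ≤ S) : conjSet S Q ⊆ (S : Set G) \ {1} := by
  rintro u ⟨hu, s, hs, hus⟩
  refine ⟨?_, hu⟩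
  have := mul_mem (mul_mem hs (hQS hus)) (inv_mem hs)
  simpa [mul_assoc] using this

variable [Finite G]

theorem ncard_sdiff_one (S : Subgroup G) : ((S : Set G) \ {1}).ncard + 1 = Nat.card S := by
  rw [Set.ncard_sdiff_singleton_add_one S.one_mem (Set.toFinite _)]
  exact Nat.card_coe_set_eq _

/-- The number of nontrivial elements in the conjugates of a subgroup with the trivial
intersection property. -/
theorem ncard_conjSet_mul_card {S Q : Subgroup G}
    (hTI : ∀ s ∈ S, ∀ q ∈ Q, q ≠ 1 → s * q * s⁻¹ ∈ Q → s ∈ Subgroup.normalizer (Q : Set G)) :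
    (conjSet S Q).ncard * Nat.card (Subgroup.normalizer (Q : Set G) ⊓ S : Subgroup G) + Nat.card S =
      Nat.card S * Nat.card Q := by
  choose t htS htQ using fun u : conjSet S Q => u.2.2
  let f : conjSet S Q × (Subgroup.normalizer (Q : Set G) ⊓ S : Subgroup G) →
      S × ((Q : Set G) \ {1} : Set G) := fun p =>
    (⟨t p.1 * p.2, mul_mem (htS p.1) p.2.2.2⟩,
      ⟨(t p.1 * p.2 : G)⁻¹ * p.1 * (t p.1 * p.2), by
        have := (Subgroup.mem_normalizer_iff.1 (inv_mem p.2.2.1) _).1 (htQ p.1)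
        simpa [mul_assoc] using this, by
        intro h
        refine p.1.2.1 ?_
        rw [Set.mem_singleton_iff, mul_assoc, inv_mul_eq_one] at h
        simpa using h⟩)
  have hf : Function.Bijective f := by
    constructor
    · rintro ⟨u, n⟩ ⟨u', n'⟩ h
      have h₁ : t u * n = t u' * n' := congrArg (fun p => (p.1 : G)) h
      have h₂ : (t u * n : G)⁻¹ * u * (t u * n) = (t u' * n' : G)⁻¹ * u' * (t u' * n') :=
        congrArg (fun p => (p.2 : G)) h
      rw [h₁] at h₂
      have huu : u = u' := Subtype.ext (mul_left_cancel (mul_right_cancel h₂))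
      subst huu
      exact Prod.ext rfl (Subtype.ext (mul_left_cancel h₁))
    · rintro ⟨⟨s, hs⟩, q, hq, hq1⟩
      have hu : s * q * s⁻¹ ∈ conjSet S Q :=
        ⟨by simpa using hq1, s, hs, by simpa [mul_assoc] using hq⟩
      have hn : (t ⟨_, hu⟩)⁻¹ * s ∈ Subgroup.normalizer (Q : Set G) ⊓ S := by
        have hmem : (t ⟨_, hu⟩)⁻¹ * s ∈ S := mul_mem (inv_mem (htS _)) hs
        refine ⟨hTI _ hmem q hq (by simpa using hq1) ?_, hmem⟩
        have := htQ ⟨_, hu⟩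
        simpa [mul_assoc] using this
      exact ⟨(⟨_, hu⟩, ⟨_, hn⟩), by simp [f, mul_assoc]⟩
  have hcard := Nat.card_congr (Equiv.ofBijective f hf)
  rw [Nat.card_prod, Nat.card_prod, Nat.card_coe_set_eq, Nat.card_coe_set_eq] at hcard
  rw [hcard, ← ncard_sdiff_one Q, mul_add, mul_one]

theorem card_le_two_mul_ncard_conjSet {S Q : Subgroup G} (hQS : Q ≤ S) (hQ : Q ≠ ⊥)
    (hTI : ∀ s ∈ S, ∀ q ∈ Q, q ≠ 1 → s * q * s⁻¹ ∈ Q → s ∈ Subgroup.normalizer (Q : Set G))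
    (hN : Subgroup.normalizer (Q : Set G) ⊓ S ≤ Q) :
    Nat.card S ≤ 2 * (conjSet S Q).ncard := by
  have h := ncard_conjSet_mul_card hTI
  rw [le_antisymm hN (le_inf Subgroup.le_normalizer hQS)] at h
  have hq : 1 < Nat.card Q := by
    rw [Subgroup.one_lt_card_iff_ne_bot]; exact hQ
  by_contra! hlt
  nlinarith

theorem exists_mem_conjSet_inter {S Q R : Subgroup G} (hQS : Q ≤ S) (hRS : R ≤ S) (hQ : Q ≠ ⊥)
    (hR : R ≠ ⊥)
    (hQTI : ∀ s ∈ S, ∀ q ∈ Q, q ≠ 1 → s * q * s⁻¹ ∈ Q → s ∈ Subgroup.normalizer (Q : Set G))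
    (hRTI : ∀ s ∈ S, ∀ q ∈ R, q ≠ 1 → s * q * s⁻¹ ∈ R → s ∈ Subgroup.normalizer (R : Set G))
    (hQN : Subgroup.normalizer (Q : Set G) ⊓ S ≤ Q)
    (hRN : Subgroup.normalizer (R : Set G) ⊓ S ≤ R) :
    (conjSet S Q ∩ conjSet S R).Nonempty := by
  by_contra hemp
  have hdisj : Disjoint (conjSet S Q) (conjSet S R) :=
    Set.disjoint_iff_inter_eq_empty.2 (Set.not_nonempty_iff_eq_empty.1 hemp)
  have h₁ := card_le_two_mul_ncard_conjSet hQS hQ hQTI hQN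
  have h₂ := card_le_two_mul_ncard_conjSet hRS hR hRTI hRN
  have h₃ := Set.ncard_le_ncard (Set.union_subset (conjSet_subset hQS) (conjSet_subset hRS))
    (Set.toFinite _)
  rw [Set.ncard_union_eq hdisj (Set.toFinite _) (Set.toFinite _)] at h₃
  have h₄ := ncard_sdiff_one S
  omega

end Counting

section Simple

theorem exists_conj_notMem {G : Type*} [Group G] [IsSimpleGroup G] {g : G} (hg : g ≠ 1)
    {H : Subgroup G} (hH : H ≠ ⊤) :
    ∃ x, x * g * x⁻¹ ∉ H := by
  by_contra! hall
  have hle : Subgroup.normalClosure {g} ≤ H := by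
    refine (Subgroup.closure_le H).2 fun y hy => ?_
    obtain ⟨a, rfl, hay⟩ := Group.mem_conjugatesOfSet_iff.1 hy
    obtain ⟨c, rfl⟩ := isConj_iff.1 hay
    exact hall c
  rcases Subgroup.Normal.eq_bot_or_eq_top
    (inferInstance : (Subgroup.normalClosure {g}).Normal) with hbot | htop
  · exact hg (Subgroup.mem_bot.1 (hbot ▸ Subgroup.subset_normalClosure rfl))
  · exact hH (top_le_iff.1 (htop ▸ hle))

variable {G : Type*} [Group G] [Finite G] [IsSimpleGroup G]

/-- A proper subgroup of a nonabelian finite simple group has index at least four. -/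
theorem four_mul_card_le_card (hnonab : ∃ a b : G, a * b ≠ b * a) {H : Subgroup G} (hH : H ≠ ⊤) :
    4 * Nat.card H ≤ Nat.card G := by
  classical
  rw [← H.card_mul_index, mul_comm]
  refine Nat.mul_le_mul_left _ ?_
  by_contra! hlt
  have : Fintype (G ⧸ H) := Fintype.ofFinite _
  obtain ⟨a, b, hab⟩ := hnonab
  let φ := MulAction.toPermHom G (G ⧸ H)
  have hφ : φ.ker = ⊥ := by
    refine (Subgroup.Normal.eq_bot_or_eq_top inferInstance).resolve_right fun htop => hH ?_
    rw [← H.normalCore_eq_ker] at htop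
    exact top_le_iff.1 (htop ▸ H.normalCore_le)
  have hinj : Function.Injective φ := (MonoidHom.ker_eq_bot_iff φ).1 hφ
  rcases Subgroup.Normal.eq_bot_or_eq_top
    (inferInstance : (Equiv.Perm.sign.comp φ).ker.Normal) with hbot | htop
  · refine hab ((MonoidHom.ker_eq_bot_iff _).1 hbot ?_)
    rw [map_mul, map_mul, mul_comm]
  · have hmem : ∀ g, φ g ∈ alternatingGroup (G ⧸ H) := fun g => by
      have : g ∈ (Equiv.Perm.sign.comp φ).ker := htop ▸ Subgroup.mem_top g
      simpa [Equiv.Perm.mem_alternatingGroup] using this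
    have hcomm : IsMulCommutative (alternatingGroup (G ⧸ H)) :=
      alternatingGroup.isMulCommutative_of_card_le_three (by
        rw [← Subgroup.index_eq_card]; omega)
    refine hab (hinj ?_)
    have := hcomm.is_comm.comm (⟨φ a, hmem a⟩ : alternatingGroup (G ⧸ H)) ⟨φ b, hmem b⟩
    rw [map_mul, map_mul]
    exact congrArg Subtype.val this

theorem coatomHull_empty : coatomHull (∅ : Set G) = ⊥ := by
  have h : coatomHull (∅ : Set G) = frattini G := by
    simp [coatomHull, frattini, Order.radical, sInf_eq_iInf]
  rw [h]
  refine (Subgroup.Normal.eq_bot_or_eq_top inferInstance).resolve_right fun htop => ?_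
  obtain ⟨H, hH, -⟩ := (eq_top_or_exists_le_coatom (⊥ : Subgroup G)).resolve_left bot_ne_top
  exact hH.1 (top_le_iff.1 (htop ▸ frattini_le_coatom hH))

theorem mem_coatomHull_symm (hex : CoatomHullExchange G) {g h : G} (hh : h ≠ 1)
    (hg : h ∈ coatomHull {g}) :
    g ∈ coatomHull {h} := by
  have := hex ∅ h g (by simpa using hg) (by simpa [coatomHull_empty] using hh)
  simpa using this

theorem coatomHull_eq_of_mem (hex : CoatomHullExchange G) {g h : G} (hh : h ≠ 1)
    (hg : h ∈ coatomHull {g}) :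
    coatomHull {h} = coatomHull {g} :=
  le_antisymm (coatomHull_le_coatomHull (by simpa using hg))
    (coatomHull_le_coatomHull (by simpa using mem_coatomHull_symm hex hh hg))

theorem mem_normalizer_of_conj_mem (hex : CoatomHullExchange G) {g s q : G}
    (hq : q ∈ coatomHull {g}) (hq1 : q ≠ 1)
    (hs : s * q * s⁻¹ ∈ coatomHull {g}) :
    s ∈ Subgroup.normalizer (coatomHull {g} : Set G) := by
  rw [Subgroup.mem_normalizer_iff]
  intro n
  have h₁ := coatomHull_eq_of_mem hex hq1 hq
  have h₂ := coatomHull_eq_of_mem hex (by simpa using hq1) hs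
  conv_rhs => rw [← h₂]
  rw [← h₁, conj_mem_coatomHull_iff]

/-- Two points which are self-normalizing in the line they span are conjugate. -/
theorem mem_conjSet_of_normalizer_inf_le (hex : CoatomHullExchange G) {g h : G}
    (hg : g ≠ 1) (hh : h ≠ 1)
    (hgN : Subgroup.normalizer (coatomHull {g} : Set G) ⊓ coatomHull {g, h} ≤ coatomHull {g})
    (hhN : Subgroup.normalizer (coatomHull {h} : Set G) ⊓ coatomHull {g, h} ≤ coatomHull {h}) :
    h ∈ conjSet ⊤ (coatomHull {g}) := by
  have hsub := subset_coatomHull ({g, h} : Set G)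
  obtain ⟨u, ⟨hu, s, -, hs⟩, -, t, -, ht⟩ := exists_mem_conjSet_inter
    (coatomHull_le_coatomHull (Set.singleton_subset_iff.2 (hsub (by simp))))
    (coatomHull_le_coatomHull (Set.singleton_subset_iff.2 (hsub (by simp))))
    (coatomHull_singleton_ne_bot hg) (coatomHull_singleton_ne_bot hh)
    (fun _ _ _ hq hq1 hs => mem_normalizer_of_conj_mem hex hq hq1 hs)
    (fun _ _ _ hq hq1 hs => mem_normalizer_of_conj_mem hex hq hq1 hs) hgN hhN
  refine ⟨hh, t⁻¹ * s, Subgroup.mem_top _, ?_⟩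
  have ht1 : t⁻¹ * u * t ≠ 1 := fun h => hu (by
    rw [mul_assoc, inv_mul_eq_one] at h
    simpa using h)
  have h₁ : h ∈ coatomHull {t⁻¹ * u * t} := mem_coatomHull_symm hex ht1 ht
  have h₂ := conj_mem_coatomHull (t⁻¹ * s)⁻¹ h₁
  have h₃ : (t⁻¹ * s)⁻¹ * (t⁻¹ * u * t) * (t⁻¹ * s)⁻¹⁻¹ = s⁻¹ * u * s := by group
  rw [h₃, inv_inv] at h₂
  exact coatomHull_le_coatomHull (by simpa using hs) h₂

theorem normalizer_coatomHull_ne_top (hnonab : ∃ a b : G, a * b ≠ b * a) {g : G} (hg : g ≠ 1) :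
    Subgroup.normalizer (coatomHull {g} : Set G) ≠ ⊤ := by
  intro htop
  rcases Subgroup.Normal.eq_bot_or_eq_top (Subgroup.normalizer_eq_top_iff.1 htop) with hbot | htop
  · exact coatomHull_singleton_ne_bot hg hbot
  · exact coatomHull_singleton_ne_top hnonab g htop

theorem not_normalizer_coatomHull_le (hex : CoatomHullExchange G)
    (hnonab : ∃ a b : G, a * b ≠ b * a) {g : G} (hg : g ≠ 1) :
    ¬ Subgroup.normalizer (coatomHull {g} : Set G) ≤ coatomHull {g} := by
  intro hN
  obtain ⟨h, hh, hhg⟩ : ∃ h : G, h ≠ 1 ∧ h ∉ conjSet ⊤ (coatomHull {g}) := by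
    by_contra! hall
    have hcard := ncard_conjSet_mul_card (S := ⊤) (Q := coatomHull {g})
      fun _ _ _ hq hq1 hs => mem_normalizer_of_conj_mem hex hq hq1 hs
    have heq : conjSet ⊤ (coatomHull {g}) = ((⊤ : Subgroup G) : Set G) \ {1} :=
      (conjSet_subset le_top).antisymm fun h hh => hall h hh.2
    have hone := ncard_sdiff_one (⊤ : Subgroup G)
    rw [inf_top_eq, le_antisymm hN Subgroup.le_normalizer, heq, ← hone] at hcard
    refine coatomHull_singleton_ne_top hnonab g (Subgroup.eq_top_of_card_eq _ ?_)
    rw [← Subgroup.card_top (G := G), ← hone]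
    linarith
  obtain ⟨H, hH, hNH⟩ := (eq_top_or_exists_le_coatom _).resolve_left
    (normalizer_coatomHull_ne_top hnonab hh)
  obtain ⟨x, hx⟩ := exists_conj_notMem hg hH.1
  have hg' : x * g * x⁻¹ ≠ 1 := by simpa using hg
  have hself : g ∈ coatomHull {g} := subset_coatomHull {g} rfl
  obtain ⟨-, s, -, hs⟩ := mem_conjSet_of_normalizer_inf_le hex (g := x * g * x⁻¹) hg' hh
    (by
      rintro s ⟨hs, -⟩
      have hs₁ := (Subgroup.mem_normalizer_iff.1 hs _).1 (conj_mem_coatomHull x hself)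
      have hs₂ : s * (x * g * x⁻¹) * s⁻¹ =
          x * ((x⁻¹ * s * x) * g * (x⁻¹ * s * x)⁻¹) * x⁻¹ := by group
      rw [hs₂, conj_mem_coatomHull_iff] at hs₁
      have hs₃ := conj_mem_coatomHull x (hN (mem_normalizer_of_conj_mem hex hself hg hs₁))
      simpa [mul_assoc] using hs₃)
    (by
      rw [Set.pair_comm]
      exact normalizer_inf_coatomHull_le hex hH hNH hx)
  refine hhg ⟨hh, s * x, Subgroup.mem_top _, (conj_mem_coatomHull_iff x).1 ?_⟩
  simpa [mul_assoc] using hs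

theorem two_mul_ncard_conjSet_lt (hex : CoatomHullExchange G)
    (hnonab : ∃ a b : G, a * b ≠ b * a) {g : G} (hg : g ≠ 1) :
    2 * (conjSet ⊤ (coatomHull {g})).ncard < Nat.card G := by
  have hcard := ncard_conjSet_mul_card (S := ⊤) (Q := coatomHull {g})
    fun _ _ _ hq hq1 hs => mem_normalizer_of_conj_mem hex hq hq1 hs
  rw [inf_top_eq, Subgroup.card_top] at hcard
  have hle : coatomHull {g} ≤ Subgroup.normalizer (coatomHull {g} : Set G) :=
    Subgroup.le_normalizer
  obtain ⟨k, hk⟩ := Subgroup.card_dvd_of_le hle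
  have hQ : 0 < Nat.card (coatomHull {g}) := Nat.card_pos
  have hG : 0 < Nat.card G := Nat.card_pos
  have hk2 : 2 ≤ k := by
    by_contra! hlt
    refine not_normalizer_coatomHull_le hex hnonab hg
      (Subgroup.eq_of_le_of_card_ge hle ?_).ge
    rw [hk]
    exact (Nat.mul_le_mul_left _ (Nat.lt_succ_iff.1 hlt)).trans (mul_one _).le
  rw [hk] at hcard
  by_contra! hge
  have h₁ := Nat.mul_le_mul hge (le_refl (Nat.card (coatomHull {g})))
  have h₂ := Nat.mul_le_mul_left
    ((conjSet ⊤ (coatomHull {g})).ncard * Nat.card (coatomHull {g})) hk2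
  nlinarith

/-- In a finite nonabelian simple group, the intersections of maximal subgroups do not form
the flats of a matroid. -/
theorem not_coatomHullExchange (hnonab : ∃ a b : G, a * b ≠ b * a) : ¬ CoatomHullExchange G := by
  classical
  intro hex
  have : Fintype G := Fintype.ofFinite G
  have hex_coatom : ∀ g : G, ∃ H : Subgroup G, g ≠ 1 →
      IsCoatom H ∧ Subgroup.normalizer (coatomHull {g} : Set G) ≤ H := by
    intro g
    by_cases hg : g = 1
    · exact ⟨⊤, fun h => absurd hg h⟩
    · obtain ⟨H, hH⟩ := (eq_top_or_exists_le_coatom _).resolve_left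
        (normalizer_coatomHull_ne_top hnonab hg)
      exact ⟨H, fun _ => hH⟩
  choose H hH using hex_coatom
  let E : Finset G := Finset.univ.erase 1
  have hE : E.card + 1 = Nat.card G := by
    rw [Finset.card_erase_add_one (Finset.mem_univ _), Nat.card_eq_fintype_card, Finset.card_univ]
  let U : G → Finset G := fun g => {h ∈ E | h ∈ conjSet ⊤ (coatomHull {g})}
  let V : G → Finset G := fun g => {h ∈ E | h ∈ H g}
  let W : G → Finset G := fun g => {h ∈ E | g ∈ H h}
  have hcover : ∀ g ∈ E, E.card ≤ (U g).card + (V g).card + (W g).card := by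
    intro g hg
    refine (Finset.card_le_card ?_).trans ((Finset.card_union_le (U g ∪ V g) (W g)).trans
      (Nat.add_le_add_right (Finset.card_union_le _ _) _))
    intro h hh
    have hg1 : g ≠ 1 := Finset.ne_of_mem_erase hg
    have hh1 : h ≠ 1 := Finset.ne_of_mem_erase hh
    simp only [U, V, W, Finset.mem_union, Finset.mem_filter, hh, true_and]
    by_contra! hnot
    refine hnot.1.1 (mem_conjSet_of_normalizer_inf_le hex hg1 hh1
      (normalizer_inf_coatomHull_le hex (hH g hg1).1 (hH g hg1).2 hnot.1.2) ?_)
    rw [Set.pair_comm]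
    exact normalizer_inf_coatomHull_le hex (hH h hh1).1 (hH h hh1).2 hnot.2
  have hU : ∀ g ∈ E, 2 * (U g).card ≤ E.card := by
    intro g hg
    have h₁ := two_mul_ncard_conjSet_lt hex hnonab (Finset.ne_of_mem_erase hg)
    have h₂ : (U g).card ≤ (conjSet ⊤ (coatomHull {g})).ncard := by
      rw [← Set.ncard_coe_finset]
      exact Set.ncard_le_ncard (fun h hh => (Finset.mem_filter.1 hh).2) (Set.toFinite _)
    omega
  have hV : ∀ g ∈ E, 4 * (V g).card + 3 ≤ E.card := by
    intro g hg
    have h₁ := four_mul_card_le_card hnonab (hH g (Finset.ne_of_mem_erase hg)).1.1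
    have h₂ : (V g).card ≤ ((H g : Set G) \ {1}).ncard := by
      rw [← Set.ncard_coe_finset]
      refine Set.ncard_le_ncard (fun h hh => ?_) (Set.toFinite _)
      exact ⟨(Finset.mem_filter.1 hh).2, Finset.ne_of_mem_erase (Finset.mem_filter.1 hh).1⟩
    have h₃ := ncard_sdiff_one (H g)
    omega
  have hVW : ∑ g ∈ E, (W g).card = ∑ g ∈ E, (V g).card :=
    Finset.sum_card_bipartiteAbove_eq_sum_card_bipartiteBelow (fun g h => g ∈ H h)
  have hpos : E.Nonempty := by
    obtain ⟨a, ha⟩ := exists_ne (1 : G)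
    exact ⟨a, Finset.mem_erase.2 ⟨ha, Finset.mem_univ a⟩⟩
  have h₁ := Finset.sum_le_sum hcover
  have h₂ := Finset.sum_le_sum hU
  have h₃ := Finset.sum_le_sum hV
  simp only [Finset.sum_add_distrib, ← Finset.mul_sum, Finset.sum_const, smul_eq_mul, hVW]
    at h₁ h₂ h₃
  have := hpos.card_pos
  omega

end Simple

/-- No finite non-abelian simple group satisfies the MGSE property. -/
theorem not_mgse_of_simple_nonabelian {G : Type*} [Group G] [Finite G]
    (hsimple : IsSimpleGroup G) (hnonab : ∃ a b : G, a * b ≠ b * a) :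
    ¬ MGSE G := by
  intro h
  exact not_coatomHullExchange hnonab fun _ _ _ hb hbA =>
    h.coatomHull_exchange (two_le_minGen hnonab) hb hbA
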